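/- There is no strongly continuous unitary representation U of ℝ² on L²(ℝ₊ × ℝ, r dr dθ) such that for every f ∈ C_c^∞(ℝ₊ × ℝ) and each j ∈ {1,2}, the map t ↦ U(t e_j)f is differentiable at 0 with derivative X_j f. In other words, the abelian two-dimensional Lie algebra spanned by X₁ and X₂ on C_c^∞(ℝ₊ × ℝ) is not extendable to a unitary representation of ℝ². -/

import Mathlib

open MeasureTheory Set

/-- The measure `r dr dθ` on `ℝ₊ × ℝ` (polar coordinates model of the Riemann
surface of `log z`). -/
noncomputable def polarMeasure : Measure (ℝ × ℝ) :=
  ((volume : Measure (ℝ × ℝ)).restrict (Set.Ioi (0:ℝ) ×ˢ Set.univ)).withDensity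
    fun p => ENNReal.ofReal p.1

/-- `C_c^∞(ℝ₊ × ℝ)`: smooth compactly supported functions with support in `ℝ₊ × ℝ`. -/
def IsLogTest (f : ℝ × ℝ → ℂ) : Prop :=
  ContDiff ℝ (⊤ : ℕ∞) f ∧ HasCompactSupport f ∧ tsupport f ⊆ Set.Ioi (0:ℝ) ×ˢ Set.univ

/-- `X₁ = cos θ ∂/∂r − (sin θ / r) ∂/∂θ`. -/
noncomputable def Xop1 (f : ℝ × ℝ → ℂ) (p : ℝ × ℝ) : ℂ :=
  (Real.cos p.2 : ℂ) * fderiv ℝ f p (1, 0) - ((Real.sin p.2 / p.1 : ℝ) : ℂ) * fderiv ℝ f p (0, 1)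

/-- `X₂ = sin θ ∂/∂r + (cos θ / r) ∂/∂θ`. -/
noncomputable def Xop2 (f : ℝ × ℝ → ℂ) (p : ℝ × ℝ) : ℂ :=
  (Real.sin p.2 : ℂ) * fderiv ℝ f p (1, 0) + ((Real.cos p.2 / p.1 : ℝ) : ℂ) * fderiv ℝ f p (0, 1)

/-- The covering map `(r, θ) ↦ (r cos θ, r sin θ)`. -/
noncomputable def polarMap (p : ℝ × ℝ) : ℝ × ℝ := (p.1 * Real.cos p.2, p.1 * Real.sin p.2)

/-- The lift of a function on the plane to the sheet `|θ - α| < π / 2`. -/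
noncomputable def sheetLift (α : ℝ) (g : ℝ × ℝ → ℂ) (p : ℝ × ℝ) : ℂ :=
  open Classical in if p.2 ∈ Ioo (α - Real.pi / 2) (α + Real.pi / 2) then g (polarMap p) else 0

/-- The open half plane with inner normal `(cos α, sin α)`. -/
def halfPlane (α : ℝ) : Set (ℝ × ℝ) := {q | 0 < q.1 * Real.cos α + q.2 * Real.sin α}

/-- Test functions on the half plane `halfPlane α`. -/
structure IsHalfPlaneTest (α : ℝ) (g : ℝ × ℝ → ℂ) : Prop where
  contDiff : ContDiff ℝ (⊤ : ℕ∞) g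
  hasCompactSupport : HasCompactSupport g
  tsupport_subset : tsupport g ⊆ halfPlane α

lemma continuous_polarMap : Continuous polarMap := by
  unfold polarMap; fun_prop

lemma contDiff_polarMap {n : WithTop ℕ∞} : ContDiff ℝ n polarMap := by
  unfold polarMap; fun_prop

lemma fderiv_polarMap_fst (p : ℝ × ℝ) :
    fderiv ℝ polarMap p (1, 0) = (Real.cos p.2, Real.sin p.2) := by
  have h : HasFDerivAt polarMap _ p :=
    (hasFDerivAt_fst.mul hasFDerivAt_snd.cos).prodMk (hasFDerivAt_fst.mul hasFDerivAt_snd.sin)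
  rw [h.fderiv]
  simp

lemma fderiv_polarMap_snd (p : ℝ × ℝ) :
    fderiv ℝ polarMap p (0, 1) = (-(p.1 * Real.sin p.2), p.1 * Real.cos p.2) := by
  have h : HasFDerivAt polarMap _ p :=
    (hasFDerivAt_fst.mul hasFDerivAt_snd.cos).prodMk (hasFDerivAt_fst.mul hasFDerivAt_snd.sin)
  rw [h.fderiv]
  simp

lemma polarMap_mem_halfPlane {α : ℝ} {p : ℝ × ℝ} :
    polarMap p ∈ halfPlane α ↔ 0 < p.1 * Real.cos (p.2 - α) := by
  simp only [polarMap, halfPlane, mem_ofPred_eq, Real.cos_sub]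
  ring_nf

instance : IsLocallyFiniteMeasure polarMeasure := by
  unfold polarMeasure
  exact IsLocallyFiniteMeasure.withDensity_ofReal continuous_fst

/-- The part of the closed sheet `|θ - α| ≤ π / 2` lying over `S`. -/
def sheetPreimage (α : ℝ) (S : Set (ℝ × ℝ)) : Set (ℝ × ℝ) :=
  {p | p.2 ∈ Icc (α - Real.pi / 2) (α + Real.pi / 2) ∧ polarMap p ∈ S}

lemma isCompact_sheetPreimage (α : ℝ) {S : Set (ℝ × ℝ)} (hS : IsCompact S) :
    IsCompact (sheetPreimage α S) := by
  obtain ⟨R, hR⟩ := hS.isBounded.exists_norm_le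
  refine ((isCompact_Icc (a := -(2 * R)) (b := 2 * R)).prod
    (isCompact_Icc (a := α - Real.pi / 2) (b := α + Real.pi / 2))).of_isClosed_subset ?_ ?_
  · exact (isClosed_Icc.preimage continuous_snd).inter (hS.isClosed.preimage continuous_polarMap)
  · rintro ⟨r, θ⟩ ⟨hθ, hp⟩
    refine ⟨?_, hθ⟩
    have h := hR _ hp
    simp only [polarMap, Prod.norm_def, Real.norm_eq_abs, sup_le_iff] at h
    have h1 := abs_le.1 h.1
    have h2 := abs_le.1 h.2
    have hR0 : 0 ≤ R := (abs_nonneg _).trans h.1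
    have h3 : r ^ 2 ≤ (2 * R) ^ 2 := by
      have e : r ^ 2 = (r * Real.cos θ) ^ 2 + (r * Real.sin θ) ^ 2 := by
        linear_combination (- r ^ 2) * Real.sin_sq_add_cos_sq θ
      have h4 := sq_le_sq' h1.1 h1.2
      have h5 := sq_le_sq' h2.1 h2.2
      nlinarith
    exact abs_le.1 (abs_le_of_sq_le_sq h3 (by positivity))

lemma pos_of_mem_sheetPreimage {α : ℝ} {S : Set (ℝ × ℝ)} (hS : S ⊆ halfPlane α) {p : ℝ × ℝ}
    (hp : p ∈ sheetPreimage α S) :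
    0 < p.1 ∧ p.2 ∈ Ioo (α - Real.pi / 2) (α + Real.pi / 2) := by
  obtain ⟨⟨h1, h2⟩, h3⟩ := hp
  have h4 := polarMap_mem_halfPlane.1 (hS h3)
  have h5 : 0 ≤ Real.cos (p.2 - α) :=
    Real.cos_nonneg_of_neg_pi_div_two_le_of_le (by linarith) (by linarith)
  have h6 : 0 < p.1 := pos_of_mul_pos_left h4 h5
  have h7 : Real.cos (p.2 - α) ≠ 0 := fun h => by simp [h] at h4
  refine ⟨h6, lt_of_le_of_ne h1 fun h => h7 ?_, lt_of_le_of_ne h2 fun h => h7 ?_⟩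
  · rw [← h, show α - Real.pi / 2 - α = -(Real.pi / 2) by ring, Real.cos_neg,
      Real.cos_pi_div_two]
  · rw [h, add_sub_cancel_left, Real.cos_pi_div_two]

lemma sheetLift_eq_zero {α : ℝ} {g : ℝ × ℝ → ℂ} {S : Set (ℝ × ℝ)}
    (hg : ∀ q, q ∉ S → g q = 0) {p : ℝ × ℝ} (hp : p ∉ sheetPreimage α S) :
    sheetLift α g p = 0 := by
  unfold sheetLift
  split_ifs with h
  · exact hg _ fun hq => hp ⟨Ioo_subset_Icc_self h, hq⟩
  · rfl

namespace IsHalfPlaneTest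

variable {α : ℝ} {g : ℝ × ℝ → ℂ}

lemma tsupport_sheetLift (h : IsHalfPlaneTest α g) :
    tsupport (sheetLift α g) ⊆ sheetPreimage α (tsupport g) := by
  refine closure_minimal (fun p hp => ?_)
    (isCompact_sheetPreimage α h.hasCompactSupport.isCompact).isClosed
  by_contra hn
  exact hp (sheetLift_eq_zero (fun q hq => image_eq_zero_of_notMem_tsupport hq) hn)

lemma sheetLift_eventuallyEq {p : ℝ × ℝ}
    (hp : p.2 ∈ Ioo (α - Real.pi / 2) (α + Real.pi / 2)) :
    sheetLift α g =ᶠ[nhds p] g ∘ polarMap := by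
  filter_upwards [(isOpen_Ioo.preimage continuous_snd).mem_nhds hp] with x hx
  have hx' : x.2 ∈ Ioo (α - Real.pi / 2) (α + Real.pi / 2) := hx
  simp only [sheetLift, if_pos hx', Function.comp]

lemma contDiff_sheetLift (h : IsHalfPlaneTest α g) :
    ContDiff ℝ (⊤ : ℕ∞) (sheetLift α g) := by
  rw [contDiff_iff_contDiffAt]
  intro p
  by_cases hp : p ∈ sheetPreimage α (tsupport g)
  · exact (h.contDiff.comp contDiff_polarMap).contDiffAt.congr_of_eventuallyEq
      (sheetLift_eventuallyEq (pos_of_mem_sheetPreimage h.tsupport_subset hp).2)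
  · exact contDiffAt_const.congr_of_eventuallyEq
      (notMem_tsupport_iff_eventuallyEq.1 fun hq => hp (h.tsupport_sheetLift hq))

lemma hasCompactSupport_sheetLift (h : IsHalfPlaneTest α g) :
    HasCompactSupport (sheetLift α g) :=
  (isCompact_sheetPreimage α h.hasCompactSupport.isCompact).of_isClosed_subset
    (isClosed_tsupport _) h.tsupport_sheetLift

lemma isLogTest (h : IsHalfPlaneTest α g) : IsLogTest (sheetLift α g) :=
  ⟨h.contDiff_sheetLift, h.hasCompactSupport_sheetLift, fun _ hp =>
    ⟨(pos_of_mem_sheetPreimage h.tsupport_subset (h.tsupport_sheetLift hp)).1, mem_univ _⟩⟩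

lemma memLp (h : IsHalfPlaneTest α g) : MemLp (sheetLift α g) 2 polarMeasure :=
  h.contDiff_sheetLift.continuous.memLp_of_hasCompactSupport h.hasCompactSupport_sheetLift

/-- The class in `L²` of the lift of a test function. -/
noncomputable def toL2 (h : IsHalfPlaneTest α g) : Lp ℂ 2 polarMeasure := h.memLp.toLp

lemma coeFn_toL2 (h : IsHalfPlaneTest α g) : h.toL2 =ᵐ[polarMeasure] sheetLift α g :=
  h.memLp.coeFn_toLp

lemma toL2_congr {β : ℝ} {g' : ℝ × ℝ → ℂ} (h : IsHalfPlaneTest α g) (h' : IsHalfPlaneTest β g')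
    (e : sheetLift α g = sheetLift β g') : h.toL2 = h'.toL2 := by
  unfold toL2; congr

lemma fderiv_apply (h : IsHalfPlaneTest α g) (v : ℝ × ℝ) :
    IsHalfPlaneTest α fun q => fderiv ℝ g q v where
  contDiff := (h.contDiff.fderiv_right (m := (⊤ : ℕ∞)) (by simp)).clm_apply contDiff_const
  hasCompactSupport := h.hasCompactSupport.fderiv_apply ℝ v
  tsupport_subset := (tsupport_fderiv_apply_subset ℝ v).trans h.tsupport_subset

lemma translate (h : IsHalfPlaneTest α g) {v : ℝ × ℝ}
    (hv : v.1 * Real.cos α + v.2 * Real.sin α = 0) (t : ℝ) :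
    IsHalfPlaneTest α fun q => g (q + t • v) where
  contDiff := h.contDiff.comp (contDiff_id.add contDiff_const)
  hasCompactSupport := h.hasCompactSupport.comp_homeomorph (Homeomorph.addRight (t • v))
  tsupport_subset := by
    have e := tsupport_comp_eq_preimage g (Homeomorph.addRight (t • v))
    intro q hq
    have hq' : q + t • v ∈ tsupport g := by
      have : q ∈ Homeomorph.addRight (t • v) ⁻¹' tsupport g := e ▸ hq
      exact this
    have := h.tsupport_subset hq'
    simp only [halfPlane, mem_ofPred_eq, Prod.fst_add, Prod.snd_add, Prod.smul_fst, Prod.smul_snd,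
      smul_eq_mul] at this ⊢
    linear_combination this + t * hv

lemma fderiv_sheetLift (h : IsHalfPlaneTest α g) (p w : ℝ × ℝ) :
    fderiv ℝ (sheetLift α g) p w =
      sheetLift α (fun q => fderiv ℝ g q (fderiv ℝ polarMap p w)) p := by
  by_cases hp : p.2 ∈ Ioo (α - Real.pi / 2) (α + Real.pi / 2)
  · rw [(sheetLift_eventuallyEq hp).fderiv_eq, fderiv_comp]
    · simp only [sheetLift, if_pos hp, ContinuousLinearMap.comp_apply]
    · exact (h.contDiff.differentiable (by simp)).differentiableAt
    · exact ((contDiff_polarMap (n := 1)).differentiable (by simp)).differentiableAt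
  · have h0 : p ∉ tsupport (sheetLift α g) := fun hq =>
      hp (pos_of_mem_sheetPreimage h.tsupport_subset (h.tsupport_sheetLift hq)).2
    rw [(notMem_tsupport_iff_eventuallyEq.1 h0).fderiv_eq]
    simp only [sheetLift, if_neg hp, fderiv_zero, Pi.zero_apply, zero_apply]

lemma Xop1_sheetLift (h : IsHalfPlaneTest α g) {p : ℝ × ℝ} (hp : p.1 ≠ 0) :
    Xop1 (sheetLift α g) p = sheetLift α (fun q => fderiv ℝ g q (1, 0)) p := by
  simp only [Xop1, h.fderiv_sheetLift, fderiv_polarMap_fst, fderiv_polarMap_snd]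
  unfold sheetLift
  split_ifs
  · simp only [← Complex.real_smul, ← map_smul, ← map_sub]
    congr 1
    ext
    · simp; field_simp; linarith [Real.sin_sq_add_cos_sq p.2]
    · simp; field_simp; ring
  · simp

lemma Xop2_sheetLift (h : IsHalfPlaneTest α g) {p : ℝ × ℝ} (hp : p.1 ≠ 0) :
    Xop2 (sheetLift α g) p = sheetLift α (fun q => fderiv ℝ g q (0, 1)) p := by
  simp only [Xop2, h.fderiv_sheetLift, fderiv_polarMap_fst, fderiv_polarMap_snd]
  unfold sheetLift
  split_ifs
  · simp only [← Complex.real_smul, ← map_smul, ← map_add]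
    congr 1
    ext
    · simp; field_simp; ring
    · simp; field_simp; linarith [Real.sin_sq_add_cos_sq p.2]
  · simp

end IsHalfPlaneTest

lemma ae_polarMeasure_iff {P : ℝ × ℝ → Prop} :
    (∀ᵐ p ∂polarMeasure, P p) ↔ ∀ᵐ p ∂(volume : Measure (ℝ × ℝ)), 0 < p.1 → P p := by
  unfold polarMeasure
  rw [ae_withDensity_iff (by fun_prop), ae_restrict_iff' (by measurability)]
  refine Filter.eventually_congr (Filter.Eventually.of_forall fun p => ?_)
  simp +contextual [ENNReal.ofReal_eq_zero]

lemma Lp_norm_le_of_bound_of_support {K : Set (ℝ × ℝ)} (hK : IsCompact K) :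
    ∃ M : ℝ, 0 ≤ M ∧ ∀ (F : Lp ℂ 2 polarMeasure) (f : ℝ × ℝ → ℂ) (C : ℝ),
      F =ᵐ[polarMeasure] f → (∀ p, ‖f p‖ ≤ C) → (∀ p, p ∉ K → f p = 0) → ‖F‖ ≤ C * M := by
  refine ⟨‖indicatorConstLp 2 hK.measurableSet hK.measure_lt_top.ne (1 : ℂ)
    (μ := polarMeasure)‖, norm_nonneg _, fun F f C hF hC h0 => ?_⟩
  refine Lp.norm_le_mul_norm_of_ae_le_mul ?_
  filter_upwards [hF, indicatorConstLp_coeFn (p := 2) (hs := hK.measurableSet)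
    (hμs := hK.measure_lt_top.ne) (c := (1 : ℂ)) (μ := polarMeasure)] with p h1 h2
  rw [h1, h2]
  by_cases hp : p ∈ K
  · simpa [hp] using hC p
  · simp [hp, h0 p hp]

namespace IsHalfPlaneTest

variable {α : ℝ} {g : ℝ × ℝ → ℂ}

lemma taylor_bound (h : IsHalfPlaneTest α g) (v : ℝ × ℝ) :
    ∃ C : ℝ, ∀ (q : ℝ × ℝ) (t : ℝ), ‖g (q + t • v) - g q - t • fderiv ℝ g q v‖ ≤ C * t ^ 2 := by
  obtain ⟨C, hC⟩ := ContDiff.lipschitzWith_of_hasCompactSupport (n := 1)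
    (h.hasCompactSupport.fderiv ℝ)
    (h.contDiff.fderiv_right (m := 1) (WithTop.coe_le_coe.2 le_top)) (by simp)
  refine ⟨C * ‖v‖ ^ 2, fun q t => ?_⟩
  have key := (convex_closedBall q (‖t • v‖)).norm_image_sub_le_of_norm_fderiv_le' (𝕜 := ℝ)
    (f := g) (φ := fderiv ℝ g q) (C := C * ‖t • v‖) (x := q) (y := q + t • v)
    (fun x _ => (h.contDiff.differentiable (by simp)).differentiableAt)
    (fun x hx => by
      refine (hC.norm_sub_le x q).trans ?_
      gcongr
      simpa [dist_eq_norm] using hx)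
    (by simp) (by simp)
  rw [add_sub_cancel_left, map_smul] at key
  refine key.trans (le_of_eq ?_)
  rw [norm_smul, Real.norm_eq_abs, ← sq_abs t]
  ring

lemma hasDerivAt_toL2_translate (h : IsHalfPlaneTest α g) {v : ℝ × ℝ}
    (hv : v.1 * Real.cos α + v.2 * Real.sin α = 0) :
    HasDerivAt (fun t : ℝ => (h.translate hv t).toL2) (h.fderiv_apply v).toL2 0 := by
  set S : Set (ℝ × ℝ) :=
    image (fun x : (ℝ × ℝ) × ℝ => x.1 - x.2 • v) (tsupport g ×ˢ Icc (-1) 1)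
  have hS : IsCompact S :=
    (h.hasCompactSupport.isCompact.prod isCompact_Icc).image (by fun_prop)
  obtain ⟨M, hM0, hM⟩ := Lp_norm_le_of_bound_of_support (isCompact_sheetPreimage α hS)
  obtain ⟨C, hC⟩ := h.taylor_bound v
  have h_zero : ∀ t ∈ Icc (-1 : ℝ) 1, ∀ q, q ∉ S → q + t • v ∉ tsupport g := fun t ht q hq hq' =>
    hq ⟨(q + t • v, t), ⟨hq', ht⟩, by simp⟩
  rw [hasDerivAt_iff_isLittleO_nhds_zero]
  refine (Asymptotics.IsBigO.of_bound (C * M) ?_).trans_isLittleO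
    (Asymptotics.isLittleO_pow_id (n := 2) (by norm_num))
  filter_upwards [Icc_mem_nhds (show (-1 : ℝ) < 0 by norm_num) zero_lt_one] with t ht
  have hae : (((h.translate hv (0 + t)).toL2 - (h.translate hv 0).toL2
      - t • (h.fderiv_apply v).toL2 : Lp ℂ 2 polarMeasure) : ℝ × ℝ → ℂ) =ᵐ[polarMeasure]
      sheetLift α fun q => g (q + t • v) - g q - t • fderiv ℝ g q v := by
    filter_upwards [Lp.coeFn_sub ((h.translate hv (0 + t)).toL2 - (h.translate hv 0).toL2)
      (t • (h.fderiv_apply v).toL2),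
      Lp.coeFn_sub (h.translate hv (0 + t)).toL2 (h.translate hv 0).toL2,
      Lp.coeFn_smul t (h.fderiv_apply v).toL2, (h.translate hv (0 + t)).coeFn_toL2,
      (h.translate hv 0).coeFn_toL2, (h.fderiv_apply v).coeFn_toL2] with p h1 h2 h3 h4 h5 h6
    rw [h1, Pi.sub_apply, h2, Pi.sub_apply, h3, Pi.smul_apply, h4, h5, h6]
    unfold sheetLift
    split_ifs <;> simp
  refine (hM _ _ (C * t ^ 2) hae (fun p => ?_) fun p hp => sheetLift_eq_zero (fun q hq => ?_) hp).trans
    (le_of_eq ?_)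
  · unfold sheetLift
    split_ifs
    · exact hC _ _
    · rw [norm_zero]; exact (norm_nonneg _).trans (hC 0 t)
  · have h0 : q ∉ tsupport g := by simpa using h_zero 0 (by simp) q hq
    rw [image_eq_zero_of_notMem_tsupport (h_zero t ht q hq), image_eq_zero_of_notMem_tsupport h0,
      image_eq_zero_of_notMem_tsupport fun hq' => h0 (tsupport_fderiv_apply_subset ℝ v hq')]
    simp
  · rw [Real.norm_eq_abs, abs_of_nonneg (sq_nonneg t)]; ring

/-- A one-parameter unitary group differentiating lifts of test functions along `v` acts on them
by translation, as long as `v` is parallel to the boundary of the half plane. -/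
lemma oneParameterGroup_apply {v : ℝ × ℝ} (hv : v.1 * Real.cos α + v.2 * Real.sin α = 0)
    (V : ℝ → (Lp ℂ 2 polarMeasure ≃ₗᵢ[ℂ] Lp ℂ 2 polarMeasure))
    (V_zero : V 0 = LinearIsometryEquiv.refl ℂ (Lp ℂ 2 polarMeasure))
    (V_add : ∀ s t F, V (s + t) F = V s (V t F))
    (hV : ∀ g (h : IsHalfPlaneTest α g),
      HasDerivAt (fun τ => V τ h.toL2) (h.fderiv_apply v).toL2 0)
    (h : IsHalfPlaneTest α g) (t : ℝ) : V t h.toL2 = (h.translate hv t).toL2 := by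
  have V_neg : ∀ s F, V s (V (-s) F) = F := fun s F => by rw [← V_add, add_neg_cancel, V_zero]; rfl
  have hderiv : ∀ s, HasDerivAt (fun s => V (-s) (h.translate hv s).toL2) 0 s := fun s => by
    have key := ((h.translate hv s).hasDerivAt_toL2_translate hv).sub (hV _ (h.translate hv s))
    rw [sub_self, hasDerivAt_iff_isLittleO_nhds_zero] at key
    rw [hasDerivAt_iff_isLittleO_nhds_zero]
    refine Asymptotics.isLittleO_norm_left.1 (key.norm_left.congr_left fun τ => ?_)
    have e₀ : ((h.translate hv s).translate hv 0).toL2 = (h.translate hv s).toL2 :=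
      toL2_congr _ _ (by simp)
    have e₁ : ((h.translate hv s).translate hv τ).toL2 = (h.translate hv (s + τ)).toL2 :=
      toL2_congr _ _ (congrArg _ (funext fun q => congrArg g (by
        rw [add_smul, add_right_comm, add_assoc])))
    have e₂ : V (-s) (h.translate hv s).toL2 = V (-(s + τ)) (V τ (h.translate hv s).toL2) := by
      rw [← V_add]; congr 2; ring
    have e₃ : V 0 (h.translate hv s).toL2 = (h.translate hv s).toL2 := by rw [V_zero]; rfl
    simp only [Pi.sub_apply, e₀, e₂, e₃, zero_add, sub_self, sub_zero, smul_zero]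
    rw [e₁]
    rw [← map_sub, LinearIsometryEquiv.norm_map]
  have hconst := is_const_of_deriv_eq_zero (fun s => (hderiv s).differentiableAt)
    (fun s => (hderiv s).deriv) 0 t
  have h0 : (h.translate hv 0).toL2 = h.toL2 := toL2_congr _ _ (by simp)
  simp only [neg_zero, V_zero, h0] at hconst
  change h.toL2 = _ at hconst
  rw [hconst, V_neg]

end IsHalfPlaneTest

/-- Over the intersection of two adjacent half planes the two sheets agree. -/
lemma sheetLift_eq_of_eq_add_pi_div_two {α β : ℝ} {g : ℝ × ℝ → ℂ} (h : IsHalfPlaneTest α g)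
    (h' : IsHalfPlaneTest β g) (hβ : β = α + Real.pi / 2) :
    sheetLift α g = sheetLift β g := by
  have hpi := Real.pi_pos
  subst hβ
  ext p
  by_cases hp : polarMap p ∈ tsupport g
  · have h1 := polarMap_mem_halfPlane.1 (h.tsupport_subset hp)
    have h2 := polarMap_mem_halfPlane.1 (h'.tsupport_subset hp)
    have key : p.2 ∈ Ioo (α - Real.pi / 2) (α + Real.pi / 2) ↔
        p.2 ∈ Ioo (α + Real.pi / 2 - Real.pi / 2) (α + Real.pi / 2 + Real.pi / 2) := by
      constructor
      · rintro ⟨h3, h4⟩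
        have h5 : 0 < Real.cos (p.2 - α) := Real.cos_pos_of_mem_Ioo ⟨by linarith, by linarith⟩
        have h6 : 0 < p.1 := pos_of_mul_pos_left h1 h5.le
        refine ⟨?_, by linarith⟩
        by_contra! h7
        have h8 : Real.cos (p.2 - (α + Real.pi / 2)) ≤ 0 := by
          rw [← Real.cos_neg]
          exact Real.cos_nonpos_of_pi_div_two_le_of_le (by linarith) (by linarith)
        exact absurd h2 (mul_nonpos_of_nonneg_of_nonpos h6.le h8).not_gt
      · rintro ⟨h3, h4⟩
        have h5 : 0 < Real.cos (p.2 - (α + Real.pi / 2)) :=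
          Real.cos_pos_of_mem_Ioo ⟨by linarith, by linarith⟩
        have h6 : 0 < p.1 := pos_of_mul_pos_left h2 h5.le
        refine ⟨by linarith, ?_⟩
        by_contra! h7
        have h8 : Real.cos (p.2 - α) ≤ 0 :=
          Real.cos_nonpos_of_pi_div_two_le_of_le (by linarith) (by linarith)
        exact absurd h1 (mul_nonpos_of_nonneg_of_nonpos h6.le h8).not_gt
    simp only [sheetLift, key]
  · simp only [sheetLift, image_eq_zero_of_notMem_tsupport hp, ite_self]

/-- A smooth bump function around `(1, 1)`. -/
noncomputable def cornerBump : ContDiffBump ((1, 1) : ℝ × ℝ) :=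
  ⟨1 / 4, 1 / 2, by norm_num, by norm_num⟩

/-- The bump function around `(1, 1) - w`. -/
noncomputable def shiftedBump (w q : ℝ × ℝ) : ℂ := (cornerBump (q + w) : ℝ)

lemma isHalfPlaneTest_shiftedBump {α : ℝ} {w : ℝ × ℝ}
    (h : ∀ x y : ℝ, |x + w.1 - 1| ≤ 1 / 2 → |y + w.2 - 1| ≤ 1 / 2 → (x, y) ∈ halfPlane α) :
    IsHalfPlaneTest α (shiftedBump w) := by
  have hsub : tsupport (shiftedBump w) ⊆
      Homeomorph.addRight w ⁻¹' Metric.closedBall ((1, 1) : ℝ × ℝ) (1 / 2) := by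
    refine closure_minimal (fun q hq => ?_)
      (Metric.isClosed_closedBall.preimage (Homeomorph.addRight w).continuous)
    by_contra hn
    refine hq ?_
    have h0 : cornerBump (q + w) = 0 :=
      cornerBump.zero_of_le_dist (not_le.1 hn).le
    simp [shiftedBump, h0]
  refine ⟨Complex.ofRealCLM.contDiff.comp
    (cornerBump.contDiff.comp (contDiff_id.add contDiff_const)), ?_, ?_⟩
  · exact ((Homeomorph.addRight w).isCompact_preimage.2
      (isCompact_closedBall _ _)).of_isClosed_subset (isClosed_tsupport _) hsub
  · rintro ⟨x, y⟩ hq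
    have h1 := hsub hq
    simp only [mem_preimage, Metric.mem_closedBall, Homeomorph.coe_addRight, Prod.dist_eq,
      Prod.fst_add, Prod.snd_add, Real.dist_eq, sup_le_iff] at h1
    exact h x y h1.1 h1.2

lemma toL2_shiftedBump_ne_zero (h : IsHalfPlaneTest 0 (shiftedBump 0)) : h.toL2 ≠ 0 := by
  intro h0
  have hae : ∀ᵐ p ∂polarMeasure, sheetLift 0 (shiftedBump 0) p = 0 := by
    have h1 := h.coeFn_toL2
    rw [h0] at h1
    filter_upwards [h1, Lp.coeFn_zero ℂ 2 polarMeasure] with p h2 h3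
    rw [← h2, h3]; rfl
  rw [ae_polarMeasure_iff, ae_iff] at hae
  have hopen : IsOpen {p : ℝ × ℝ | ¬(0 < p.1 → sheetLift 0 (shiftedBump 0) p = 0)} := by
    simp only [Classical.not_imp]
    exact (isOpen_Ioi.preimage continuous_fst).inter
      (isOpen_ne.preimage h.contDiff_sheetLift.continuous)
  have hempty := (hopen.measure_eq_zero_iff volume).1 hae
  have hmem : (√2, Real.pi / 4) ∈
      {p : ℝ × ℝ | ¬(0 < p.1 → sheetLift 0 (shiftedBump 0) p = 0)} := by
    have hpi := Real.pi_pos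
    have hθ : Real.pi / 4 ∈ Ioo (0 - Real.pi / 2) (0 + Real.pi / 2) :=
      ⟨by linarith, by linarith⟩
    have e : polarMap (√2, Real.pi / 4) = (1, 1) := by
      simp [polarMap, Real.cos_pi_div_four, Real.sin_pi_div_four, ← mul_div_assoc]
    have e1 : cornerBump (1, 1) = 1 :=
      cornerBump.one_of_mem_closedBall (Metric.mem_closedBall_self cornerBump.rIn_pos.le)
    simp only [mem_ofPred_eq, Classical.not_imp]
    refine ⟨by positivity, ?_⟩
    simp only [sheetLift, if_pos hθ, e, shiftedBump, add_zero, e1]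
    simp
  rw [hempty] at hmem
  exact hmem

lemma toL2_eq_zero_of_eq {α β : ℝ} {g : ℝ × ℝ → ℂ} (h : IsHalfPlaneTest α g)
    (h' : IsHalfPlaneTest β g) (hαβ : β + Real.pi ≤ α) (e : h.toL2 = h'.toL2) : h.toL2 = 0 := by
  rw [Lp.eq_zero_iff_ae_eq_zero]
  have h2 := h'.coeFn_toL2
  rw [← e] at h2
  filter_upwards [h.coeFn_toL2, h2] with p h3 h4
  by_cases hp : p.2 ∈ Ioo (α - Real.pi / 2) (α + Real.pi / 2)
  · have hp' : p.2 ∉ Ioo (β - Real.pi / 2) (β + Real.pi / 2) := fun hq => by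
      linarith [hp.1, hq.2]
    rw [h4, sheetLift, if_neg hp']; rfl
  · rw [h3, sheetLift, if_neg hp]; rfl

/-- There is no strongly continuous unitary representation `U` of `ℝ²`
on `L²(ℝ₊ × ℝ, r dr dθ)` whose partial derivatives at `0` on `C_c^∞(ℝ₊ × ℝ)` are
`X₁` and `X₂`; i.e. the abelian Lie algebra spanned by `X₁, X₂` is not extendable
to a unitary representation of `ℝ²`. -/
theorem stmt5 :
    ¬ ∃ U : ℝ × ℝ → (Lp ℂ 2 polarMeasure ≃ₗᵢ[ℂ] Lp ℂ 2 polarMeasure),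
      U 0 = LinearIsometryEquiv.refl ℂ (Lp ℂ 2 polarMeasure) ∧
      (∀ s t : ℝ × ℝ, ∀ F : Lp ℂ 2 polarMeasure, U (s + t) F = U s (U t F)) ∧
      (∀ F : Lp ℂ 2 polarMeasure, Continuous fun t : ℝ × ℝ => U t F) ∧
      (∀ (f : ℝ × ℝ → ℂ), IsLogTest f → ∀ F G₁ G₂ : Lp ℂ 2 polarMeasure,
        ⇑F =ᵐ[polarMeasure] f → ⇑G₁ =ᵐ[polarMeasure] Xop1 f → ⇑G₂ =ᵐ[polarMeasure] Xop2 f →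
        HasDerivAt (fun τ : ℝ => U (τ, 0) F) G₁ 0 ∧
        HasDerivAt (fun τ : ℝ => U (0, τ) F) G₂ 0) := by
  rintro ⟨U, U_zero, U_add, -, hU⟩
  have hpos : ∀ᵐ p ∂polarMeasure, p.1 ≠ 0 :=
    ae_polarMeasure_iff.2 (Filter.Eventually.of_forall fun p hp => hp.ne')
  have hderiv : ∀ α g (h : IsHalfPlaneTest α g),
      HasDerivAt (fun τ : ℝ => U (τ, 0) h.toL2) (h.fderiv_apply (1, 0)).toL2 0 ∧
      HasDerivAt (fun τ : ℝ => U (0, τ) h.toL2) (h.fderiv_apply (0, 1)).toL2 0 := fun α g h => by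
    refine hU _ h.isLogTest _ _ _ h.coeFn_toL2 ?_ ?_
    · filter_upwards [(h.fderiv_apply (1, 0)).coeFn_toL2, hpos] with p h1 h2
      rw [h1, h.Xop1_sheetLift h2]
    · filter_upwards [(h.fderiv_apply (0, 1)).coeFn_toL2, hpos] with p h1 h2
      rw [h1, h.Xop2_sheetLift h2]
  have horizontal : ∀ {α : ℝ} {w w' : ℝ × ℝ} (h : IsHalfPlaneTest α (shiftedBump w))
      (h' : IsHalfPlaneTest α (shiftedBump w')), Real.cos α = 0 → w' = (2, 0) + w →
      U (2, 0) h.toL2 = h'.toL2 := fun {α w w'} h h' hα hw => by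
    rw [IsHalfPlaneTest.oneParameterGroup_apply (v := (1, 0)) (by simp [hα])
      (fun τ => U (τ, 0)) U_zero (fun s t F => by rw [← U_add]; simp)
      (fun g h => (hderiv α g h).1) h 2]
    refine IsHalfPlaneTest.toL2_congr _ _ (congrArg _ (funext fun q => ?_))
    simp [shiftedBump, hw, add_assoc]
  have vertical : ∀ {α : ℝ} {w w' : ℝ × ℝ} (h : IsHalfPlaneTest α (shiftedBump w))
      (h' : IsHalfPlaneTest α (shiftedBump w')), Real.sin α = 0 → w' = (0, 2) + w →
      U (0, 2) h.toL2 = h'.toL2 := fun {α w w'} h h' hα hw => by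
    rw [IsHalfPlaneTest.oneParameterGroup_apply (v := (0, 1)) (by simp [hα])
      (fun τ => U (0, τ)) U_zero (fun s t F => by rw [← U_add]; simp)
      (fun g h => (hderiv α g h).2) h 2]
    refine IsHalfPlaneTest.toL2_congr _ _ (congrArg _ (funext fun q => ?_))
    simp [shiftedBump, hw, add_assoc]
  have right : ∀ w : ℝ × ℝ, w.1 = 0 → IsHalfPlaneTest 0 (shiftedBump w) := fun w hw =>
    isHalfPlaneTest_shiftedBump fun x y hx hy => by
      simp only [halfPlane, mem_ofPred_eq, Real.cos_zero, Real.sin_zero]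
      linarith [(abs_le.1 hx).1]
  have upper : ∀ w : ℝ × ℝ, w.2 = 0 → IsHalfPlaneTest (Real.pi / 2) (shiftedBump w) := fun w hw =>
    isHalfPlaneTest_shiftedBump fun x y hx hy => by
      simp only [halfPlane, mem_ofPred_eq, Real.cos_pi_div_two, Real.sin_pi_div_two]
      linarith [(abs_le.1 hy).1]
  have left : ∀ w : ℝ × ℝ, w.1 = 2 → IsHalfPlaneTest Real.pi (shiftedBump w) := fun w hw =>
    isHalfPlaneTest_shiftedBump fun x y hx hy => by
      simp only [halfPlane, mem_ofPred_eq, Real.cos_pi, Real.sin_pi]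
      linarith [(abs_le.1 hx).2]
  have lower : ∀ w : ℝ × ℝ, w.2 = 2 → IsHalfPlaneTest (-(Real.pi / 2)) (shiftedBump w) :=
    fun w hw => isHalfPlaneTest_shiftedBump fun x y hx hy => by
      simp only [halfPlane, mem_ofPred_eq, Real.cos_neg, Real.sin_neg, Real.cos_pi_div_two,
        Real.sin_pi_div_two]
      linarith [(abs_le.1 hy).2]
  have counterclockwise : U (0, 2) (U (2, 0) (right 0 rfl).toL2) = (left (2, 2) rfl).toL2 := by
    rw [IsHalfPlaneTest.toL2_congr (right 0 rfl) (upper 0 rfl)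
        (sheetLift_eq_of_eq_add_pi_div_two (right 0 rfl) (upper 0 rfl) (by ring)),
      horizontal (upper 0 rfl) (upper (2, 0) rfl) Real.cos_pi_div_two (by simp),
      IsHalfPlaneTest.toL2_congr (upper (2, 0) rfl) (left (2, 0) rfl)
        (sheetLift_eq_of_eq_add_pi_div_two (upper (2, 0) rfl) (left (2, 0) rfl) (by ring)),
      vertical (left (2, 0) rfl) (left (2, 2) rfl) Real.sin_pi (by simp)]
  have clockwise : U (2, 0) (U (0, 2) (right 0 rfl).toL2) = (lower (2, 2) rfl).toL2 := by
    rw [vertical (right 0 rfl) (right (0, 2) rfl) Real.sin_zero (by simp),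
      IsHalfPlaneTest.toL2_congr (right (0, 2) rfl) (lower (0, 2) rfl)
        (sheetLift_eq_of_eq_add_pi_div_two (lower (0, 2) rfl) (right (0, 2) rfl) (by ring)).symm,
      horizontal (lower (0, 2) rfl) (lower (2, 2) rfl) (by simp) (by simp)]
  have hcomm : (left (2, 2) rfl).toL2 = (lower (2, 2) rfl).toL2 := by
    rw [← counterclockwise, ← clockwise, ← U_add, ← U_add, add_comm]
  have h0 := toL2_eq_zero_of_eq _ _ (by linarith [Real.pi_pos]) hcomm
  rw [← counterclockwise] at h0
  exact toL2_shiftedBump_ne_zero (right 0 rfl) (by simpa using h0)
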